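/- Let R : {1,2,3,4}⁴ → ℝ be an algebraic curvature tensor (R_{μνρσ} = −R_{νμρσ} = −R_{μνσρ} = R_{ρσμν} and R_{μνρσ} + R_{μρσν} + R_{μσνρ} = 0), let Fⁱ_{μν} := (1/2) ∑_{ρ,σ} R_{μνρσ} Sⁱ_{ρσ}, Ric_{μν} := ∑_α R_{μανα}, and let Λ ∈ ℝ. Then the following are equivalent: (a) there exists a symmetric real 3×3 matrix Ψ with tr(Ψ) = 0 such that Fⁱ_{μν} = ∑_j (Ψ^{ij} + (Λ/3) δ^{ij}) Sʲ_{μν} for all i, μ, ν; (b) Ric_{μν} = Λ δ_{μν} for all μ, ν (the Einstein condition). Moreover, each Fⁱ is self-dual as a 2-form (i.e. (1/2) ∑_{ρ,σ} ε_{μνρσ} Fⁱ_{ρσ} = Fⁱ_{μν} for all i, μ, ν) if and only if the trace-free part of Ric vanishes, i.e. Ric_{μν} = (s/4) δ_{μν} where s := ∑_μ Ric_{μμ}. -/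

import Mathlib

open Matrix BigOperators

/-- Levi-Civita symbol on four indices, `ε 0 1 2 3 = 1`. -/
noncomputable def eps4 (μ ν ρ σ : Fin 4) : ℝ :=
  Matrix.det (Matrix.of fun a b => if ![μ, ν, ρ, σ] a = b then (1 : ℝ) else 0)

/-- The canonical matrices `S¹, S², S³`. -/
def Scan : Fin 3 → Matrix (Fin 4) (Fin 4) ℝ :=
  ![!![0, 0, 0, -1; 0, 0, -1, 0; 0, 1, 0, 0; 1, 0, 0, 0],
    !![0, 0, 1, 0; 0, 0, 0, -1; -1, 0, 0, 0; 0, 1, 0, 0],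
    !![0, -1, 0, 0; 1, 0, 0, 0; 0, 0, 0, -1; 0, 0, 1, 0]]

set_option linter.unusedSimpArgs false

/-- Explicit integer formula for the Levi-Civita symbol. -/
def epsZ (μ ν ρ σ : Fin 4) : ℤ :=
  (((ν : ℕ) : ℤ) - (μ : ℕ)) * (((ρ : ℕ) : ℤ) - (μ : ℕ)) * (((σ : ℕ) : ℤ) - (μ : ℕ)) *
    (((ρ : ℕ) : ℤ) - (ν : ℕ)) * (((σ : ℕ) : ℤ) - (ν : ℕ)) * (((σ : ℕ) : ℤ) - (ρ : ℕ)) / 12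

theorem det_int_eq : ∀ μ ν ρ σ : Fin 4,
    Matrix.det (Matrix.of fun a b => if ![μ, ν, ρ, σ] a = b then (1 : ℤ) else 0)
      = epsZ μ ν ρ σ := by
  decide +kernel

theorem eps4_eq (μ ν ρ σ : Fin 4) : eps4 μ ν ρ σ = (epsZ μ ν ρ σ : ℝ) := by
  rw [← det_int_eq, Int.cast_det, eps4]
  congr 1
  ext a b
  simp [Matrix.map_apply]

/-- Self-duality of an antisymmetric array, componentwise. -/
theorem dual_iff (G : Fin 4 → Fin 4 → ℝ) (hG : ∀ a b, G a b = -G b a) :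
    (∀ μ ν, (1 / 2) * (∑ ρ, ∑ σ, eps4 μ ν ρ σ * G ρ σ) = G μ ν) ↔
      (G 0 1 = G 2 3 ∧ G 0 2 = -G 1 3 ∧ G 0 3 = G 1 2) := by
  have d : ∀ a, G a a = 0 := fun a => by linarith [hG a a]
  have h10 := hG 1 0
  have h20 := hG 2 0
  have h30 := hG 3 0
  have h21 := hG 2 1
  have h31 := hG 3 1
  have h32 := hG 3 2
  simp only [eps4_eq, Fin.forall_fin_succ, Fin.sum_univ_four, Fin.forall_fin_zero]
  simp [epsZ, d, h10, h20, h30, h21, h31, h32]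
  constructor
  · intro h
    refine ⟨?_, ?_, ?_⟩ <;> linarith
  · rintro ⟨h1, h2, h3⟩
    simp [h1, h2, h3]
    refine ⟨?_, ?_⟩ <;> ring_nf <;> simp

/-- the Einstein condition `Ric = Λδ` is equivalent to
`Fⁱ = (Ψ^{ij} + (Λ/3)δ^{ij}) Sʲ` with `Ψ` symmetric trace-free; moreover each
`Fⁱ` is self-dual iff the trace-free Ricci vanishes. -/
theorem einstein_condition_via_F
    (R : Fin 4 → Fin 4 → Fin 4 → Fin 4 → ℝ)
    (hA1 : ∀ μ ν ρ σ, R μ ν ρ σ = -R ν μ ρ σ)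
    (hA2 : ∀ μ ν ρ σ, R μ ν ρ σ = -R μ ν σ ρ)
    (hPair : ∀ μ ν ρ σ, R μ ν ρ σ = R ρ σ μ ν)
    (hBianchi : ∀ μ ν ρ σ, R μ ν ρ σ + R μ ρ σ ν + R μ σ ν ρ = 0)
    (Λ : ℝ) :
    let F : Fin 3 → Fin 4 → Fin 4 → ℝ :=
      fun i μ ν => (1 / 2) * ∑ ρ, ∑ σ, R μ ν ρ σ * Scan i ρ σ
    let Ric : Fin 4 → Fin 4 → ℝ := fun μ ν => ∑ α, R μ α ν α
    let s : ℝ := ∑ μ, Ric μ μ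
    ((∃ Ψ : Fin 3 → Fin 3 → ℝ, (∀ i j, Ψ i j = Ψ j i) ∧ (∑ i, Ψ i i) = 0 ∧
        ∀ i μ ν, F i μ ν
          = ∑ j, (Ψ i j + (Λ / 3) * (if i = j then 1 else 0)) * Scan j μ ν) ↔
      (∀ μ ν, Ric μ ν = Λ * (if μ = ν then 1 else 0))) ∧
    ((∀ i μ ν, (1 / 2) * (∑ ρ, ∑ σ, eps4 μ ν ρ σ * F i ρ σ) = F i μ ν) ↔
      (∀ μ ν, Ric μ ν = (s / 4) * (if μ = ν then 1 else 0))) := by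
  intro F Ric s
  have hd1 : ∀ a c d, R a a c d = 0 := fun a c d => by linarith [hA1 a a c d]
  have hd2 : ∀ a c d, R c d a a = 0 := fun a c d => by linarith [hA2 c d a a]
  have ha10 := hA1 1 0
  have hb10 := fun c d => hA2 c d 1 0
  have ha20 := hA1 2 0
  have hb20 := fun c d => hA2 c d 2 0
  have ha30 := hA1 3 0
  have hb30 := fun c d => hA2 c d 3 0
  have ha21 := hA1 2 1
  have hb21 := fun c d => hA2 c d 2 1
  have ha31 := hA1 3 1
  have hb31 := fun c d => hA2 c d 3 1
  have ha32 := hA1 3 2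
  have hb32 := fun c d => hA2 c d 3 2
  have hp0201 := hPair 0 2 0 1
  have hp0301 := hPair 0 3 0 1
  have hp0302 := hPair 0 3 0 2
  have hp1201 := hPair 1 2 0 1
  have hp1202 := hPair 1 2 0 2
  have hp1203 := hPair 1 2 0 3
  have hp1301 := hPair 1 3 0 1
  have hp1302 := hPair 1 3 0 2
  have hp1303 := hPair 1 3 0 3
  have hp1312 := hPair 1 3 1 2
  have hp2301 := hPair 2 3 0 1
  have hp2302 := hPair 2 3 0 2
  have hp2303 := hPair 2 3 0 3
  have hp2312 := hPair 2 3 1 2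
  have hp2313 := hPair 2 3 1 3
  have hB : R 0 1 2 3 = R 0 2 1 3 - R 0 3 1 2 := by
    have h := hBianchi 0 1 2 3
    rw [hb31] at h
    linarith
  have hFanti : ∀ i a b, F i a b = -F i b a := by
    intro i a b
    simp only [F]
    rw [← mul_neg, ← Finset.sum_neg_distrib]
    congr 1
    refine Finset.sum_congr rfl fun ρ _ => ?_
    rw [← Finset.sum_neg_distrib]
    refine Finset.sum_congr rfl fun σ _ => ?_
    rw [hA1 a b]
    ring
  have hFd : ∀ i a, F i a a = 0 := fun i a => by linarith [hFanti i a a]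
  have hRsymm : ∀ a b, Ric a b = Ric b a := by
    intro a b
    exact Finset.sum_congr rfl fun α _ => hPair a α b α
  have F0 : ∀ a b, F 0 a b = -R a b 0 3 - R a b 1 2 := by
    intro a b
    simp [F, Scan, Fin.sum_univ_four, hb10, hb20, hb30, hb21, hb31, hb32]
    ring
  have F1 : ∀ a b, F 1 a b = R a b 0 2 - R a b 1 3 := by
    intro a b
    simp [F, Scan, Fin.sum_univ_four, hb10, hb20, hb30, hb21, hb31, hb32]
    ring
  have F2 : ∀ a b, F 2 a b = -R a b 0 1 - R a b 2 3 := by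
    intro a b
    simp [F, Scan, Fin.sum_univ_four, hb10, hb20, hb30, hb21, hb31, hb32]
    ring
  have r00 : Ric 0 0 = R 0 1 0 1 + R 0 2 0 2 + R 0 3 0 3 := by
    simp [Ric, Fin.sum_univ_four,
      hd1, hd2, ha10, hb10, ha20, hb20, ha30, hb30, ha21, hb21, ha31, hb31, ha32, hb32,
      hp0201, hp0301, hp0302, hp1201, hp1202, hp1203, hp1301, hp1302, hp1303, hp1312,
      hp2301, hp2302, hp2303, hp2312, hp2313]
    try ring
  have r01 : Ric 0 1 = R 0 2 1 2 + R 0 3 1 3 := by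
    simp [Ric, Fin.sum_univ_four,
      hd1, hd2, ha10, hb10, ha20, hb20, ha30, hb30, ha21, hb21, ha31, hb31, ha32, hb32,
      hp0201, hp0301, hp0302, hp1201, hp1202, hp1203, hp1301, hp1302, hp1303, hp1312,
      hp2301, hp2302, hp2303, hp2312, hp2313]
    try ring
  have r02 : Ric 0 2 = -R 0 1 1 2 + R 0 3 2 3 := by
    simp [Ric, Fin.sum_univ_four,
      hd1, hd2, ha10, hb10, ha20, hb20, ha30, hb30, ha21, hb21, ha31, hb31, ha32, hb32,
      hp0201, hp0301, hp0302, hp1201, hp1202, hp1203, hp1301, hp1302, hp1303, hp1312,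
      hp2301, hp2302, hp2303, hp2312, hp2313]
    try ring
  have r03 : Ric 0 3 = -R 0 1 1 3 - R 0 2 2 3 := by
    simp [Ric, Fin.sum_univ_four,
      hd1, hd2, ha10, hb10, ha20, hb20, ha30, hb30, ha21, hb21, ha31, hb31, ha32, hb32,
      hp0201, hp0301, hp0302, hp1201, hp1202, hp1203, hp1301, hp1302, hp1303, hp1312,
      hp2301, hp2302, hp2303, hp2312, hp2313]
    try ring
  have r11 : Ric 1 1 = R 0 1 0 1 + R 1 2 1 2 + R 1 3 1 3 := by
    simp [Ric, Fin.sum_univ_four,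
      hd1, hd2, ha10, hb10, ha20, hb20, ha30, hb30, ha21, hb21, ha31, hb31, ha32, hb32,
      hp0201, hp0301, hp0302, hp1201, hp1202, hp1203, hp1301, hp1302, hp1303, hp1312,
      hp2301, hp2302, hp2303, hp2312, hp2313]
    try ring
  have r12 : Ric 1 2 = R 0 1 0 2 + R 1 3 2 3 := by
    simp [Ric, Fin.sum_univ_four,
      hd1, hd2, ha10, hb10, ha20, hb20, ha30, hb30, ha21, hb21, ha31, hb31, ha32, hb32,
      hp0201, hp0301, hp0302, hp1201, hp1202, hp1203, hp1301, hp1302, hp1303, hp1312,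
      hp2301, hp2302, hp2303, hp2312, hp2313]
    try ring
  have r13 : Ric 1 3 = R 0 1 0 3 - R 1 2 2 3 := by
    simp [Ric, Fin.sum_univ_four,
      hd1, hd2, ha10, hb10, ha20, hb20, ha30, hb30, ha21, hb21, ha31, hb31, ha32, hb32,
      hp0201, hp0301, hp0302, hp1201, hp1202, hp1203, hp1301, hp1302, hp1303, hp1312,
      hp2301, hp2302, hp2303, hp2312, hp2313]
    try ring
  have r22 : Ric 2 2 = R 0 2 0 2 + R 1 2 1 2 + R 2 3 2 3 := by
    simp [Ric, Fin.sum_univ_four,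
      hd1, hd2, ha10, hb10, ha20, hb20, ha30, hb30, ha21, hb21, ha31, hb31, ha32, hb32,
      hp0201, hp0301, hp0302, hp1201, hp1202, hp1203, hp1301, hp1302, hp1303, hp1312,
      hp2301, hp2302, hp2303, hp2312, hp2313]
    try ring
  have r23 : Ric 2 3 = R 0 2 0 3 + R 1 2 1 3 := by
    simp [Ric, Fin.sum_univ_four,
      hd1, hd2, ha10, hb10, ha20, hb20, ha30, hb30, ha21, hb21, ha31, hb31, ha32, hb32,
      hp0201, hp0301, hp0302, hp1201, hp1202, hp1203, hp1301, hp1302, hp1303, hp1312,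
      hp2301, hp2302, hp2303, hp2312, hp2313]
    try ring
  have r33 : Ric 3 3 = R 0 3 0 3 + R 1 3 1 3 + R 2 3 2 3 := by
    simp [Ric, Fin.sum_univ_four,
      hd1, hd2, ha10, hb10, ha20, hb20, ha30, hb30, ha21, hb21, ha31, hb31, ha32, hb32,
      hp0201, hp0301, hp0302, hp1201, hp1202, hp1203, hp1301, hp1302, hp1303, hp1312,
      hp2301, hp2302, hp2303, hp2312, hp2313]
    try ring
  have ricIff : ∀ c : ℝ, (∀ μ ν, Ric μ ν = c * (if μ = ν then 1 else 0)) ↔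
      (Ric 0 0 = c ∧ Ric 1 1 = c ∧ Ric 2 2 = c ∧ Ric 3 3 = c ∧ Ric 0 1 = 0 ∧ Ric 0 2 = 0 ∧
        Ric 0 3 = 0 ∧ Ric 1 2 = 0 ∧ Ric 1 3 = 0 ∧ Ric 2 3 = 0) := by
    intro c
    constructor
    · intro h
      simp [h]
    · rintro ⟨h00, h11, h22, h33, h01, h02, h03, h12, h13, h23⟩ μ ν
      fin_cases μ <;> fin_cases ν <;>
        simp [h00, h11, h22, h33, h01, h02, h03, h12, h13, h23, hRsymm 1 0, hRsymm 2 0,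
          hRsymm 3 0, hRsymm 2 1, hRsymm 3 1, hRsymm 3 2]
  have sdIff : (∀ i, F i 0 1 = F i 2 3 ∧ F i 0 2 = -F i 1 3 ∧ F i 0 3 = F i 1 2) ↔
      (Ric 0 0 = s / 4 ∧ Ric 1 1 = s / 4 ∧ Ric 2 2 = s / 4 ∧ Ric 3 3 = s / 4 ∧ Ric 0 1 = 0 ∧
        Ric 0 2 = 0 ∧ Ric 0 3 = 0 ∧ Ric 1 2 = 0 ∧ Ric 1 3 = 0 ∧ Ric 2 3 = 0) := by
    have hs : s = Ric 0 0 + Ric 1 1 + Ric 2 2 + Ric 3 3 := Fin.sum_univ_four _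
    rw [hs, Fin.forall_fin_succ, Fin.forall_fin_succ, Fin.forall_fin_succ]
    simp only [Fin.succ_zero_eq_one, Fin.succ_one_eq_two, IsEmpty.forall_iff, and_true, F0, F1, F2,
      r00, r01, r02, r03, r11, r12, r13, r22, r23, r33,
      hp1203, hp1303, hp2303, hp1202, hp1302, hp2302, hp1201, hp1301, hp2301, hp0201, hp0301, hp0302, hp1312, hp2312, hp2313, hB]
    constructor
    · rintro ⟨⟨a1, a2, a3⟩, ⟨b1, b2, b3⟩, ⟨c1, c2, c3⟩⟩
      refine ⟨?_, ?_, ?_, ?_, ?_, ?_, ?_, ?_, ?_, ?_⟩ <;> linarith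
    · rintro ⟨h00, h11, h22, h33, h01, h02, h03, h12, h13, h23⟩
      refine ⟨⟨?_, ?_, ?_⟩, ⟨?_, ?_, ?_⟩, ⟨?_, ?_, ?_⟩⟩ <;> linarith
  have trF : s = -2 * (F 0 0 3 + F 0 1 2) + 2 * (F 1 0 2 - F 1 1 3) - 2 * (F 2 0 1 + F 2 2 3) := by
    have hs : s = Ric 0 0 + Ric 1 1 + Ric 2 2 + Ric 3 3 := Fin.sum_univ_four _
    rw [hs]
    simp only [F0, F1, F2, r00, r01, r02, r03, r11, r12, r13, r22, r23, r33,
      hp1203, hp1303, hp2303, hp1202, hp1302, hp2302, hp1201, hp1301, hp2301, hp0201, hp0301, hp0302, hp1312, hp2312, hp2313, hB]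
    ring
  constructor
  · rw [ricIff]
    constructor
    · rintro ⟨Ψ, hsym, htr, hF⟩
      simp only [Fin.sum_univ_three] at htr hF
      have hsd : ∀ i, F i 0 1 = F i 2 3 ∧ F i 0 2 = -F i 1 3 ∧ F i 0 3 = F i 1 2 := by
        intro i
        refine ⟨?_, ?_, ?_⟩ <;> rw [hF, hF] <;> simp [Scan]
      have hsL : s = 4 * Λ := by
        rw [trF]
        simp only [hF]
        simp [Scan]
        linarith
      have h := sdIff.1 hsd
      have e : s / 4 = Λ := by linarith
      rwa [e] at h
    · intro h
      have hs : s = Ric 0 0 + Ric 1 1 + Ric 2 2 + Ric 3 3 := Fin.sum_univ_four _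
      have hsL : s = 4 * Λ := by
        obtain ⟨h00, h11, h22, h33, -⟩ := h
        linarith
      have e : Λ = s / 4 := by linarith
      have hsd := sdIff.2 (by rw [← e]; exact h)
      refine ⟨fun i j => ![-F i 0 3, F i 0 2, -F i 0 1] j - Λ / 3 * (if i = j then 1 else 0),
        ?_, ?_, ?_⟩
      · have k01 : F 0 0 2 = -F 1 0 3 := by
          have h1 := (hsd 0).2.1
          have h2 := (hsd 1).2.2
          simp only [F0, F1, hp1203, hp1303, hp2303, hp1202, hp1302, hp2302, hp1201, hp1301, hp2301, hp0201, hp0301, hp0302, hp1312, hp2312, hp2313] at h1 h2 ⊢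
          linarith
        have k02 : F 0 0 1 = F 2 0 3 := by
          have h1 := (hsd 0).1
          have h2 := (hsd 2).2.2
          simp only [F0, F2, hp1203, hp1303, hp2303, hp1202, hp1302, hp2302, hp1201, hp1301, hp2301, hp0201, hp0301, hp0302, hp1312, hp2312, hp2313] at h1 h2 ⊢
          linarith
        have k12 : F 1 0 1 = -F 2 0 2 := by
          have h1 := (hsd 1).1
          have h2 := (hsd 2).2.1
          simp only [F1, F2, hp1203, hp1303, hp2303, hp1202, hp1302, hp2302, hp1201, hp1301, hp2301, hp0201, hp0301, hp0302, hp1312, hp2312, hp2313] at h1 h2 ⊢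
          linarith
        intro i j
        fin_cases i <;> fin_cases j <;> simp [k01, k02, k12]
      · simp only [Fin.sum_univ_three]
        obtain ⟨-, -, a⟩ := hsd 0
        obtain ⟨-, b, -⟩ := hsd 1
        obtain ⟨c, -, -⟩ := hsd 2
        simp
        linarith
      · intro i μ ν
        obtain ⟨a, b, c⟩ := hsd i
        have b' : F i 1 3 = -F i 0 2 := by linarith
        simp only [Fin.sum_univ_three, sub_add_cancel]
        fin_cases μ <;> fin_cases ν <;>
          simp [Scan, hFd, hFanti i 1 0, hFanti i 2 0, hFanti i 3 0, hFanti i 2 1, hFanti i 3 1,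
            hFanti i 3 2, ← a, b', ← c]
  · rw [ricIff, ← sdIff]
    exact forall_congr' fun i => dual_iff (F i) (hFanti i)
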